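/- Suppose the free energy well inequality holds, i.e. min{π_β(A₀), π_β(A₂)} ≥ exp(Ω(β·k̄/log(n/k̄)))·π_β(A₁). Then for any T > 0, the hitting time τ_β of the reversible nearest-neighbor Markov chain satisfies P(τ_β ≤ T) ≤ T·exp(−Ω(β·k̄/log(n/k̄))), with high probability as n → ∞. -/

import Mathlib

open Filter MeasureTheory Finset

noncomputable section

/-- Edge index type: unordered pairs of vertices of `Fin n`, encoded as ordered pairs `i < j`. -/
abbrev EdgeIdx (n : ℕ) := {p : Fin n × Fin n // p.1 < p.2}

/-- A graph on the vertex set `Fin n`, given by a boolean indicator on the possible edges. -/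
abbrev ERGraph (n : ℕ) := EdgeIdx n → Bool

/-- The number of edges of the subgraph of `g` induced on the vertex set `A`. -/
def edgeCount {n : ℕ} (g : ERGraph n) (A : Finset (Fin n)) : ℕ :=
  (Finset.univ.filter (fun p : EdgeIdx n => p.1.1 ∈ A ∧ p.1.2 ∈ A ∧ g p = true)).card

/-- Plant a clique on the vertex set `PC` on top of the graph `g`. -/
def plant {n : ℕ} (g : ERGraph n) (PC : Finset (Fin n)) : ERGraph n :=
  fun p => if p.1.1 ∈ PC ∧ p.1.2 ∈ PC then true else g p

instance (n : ℕ) : MeasurableSpace (Finset (Fin n)) := ⊤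

/-- The planted clique model `G(n,k,1/2)`: a uniformly random graph (i.e. `G(n,1/2)`)
together with a uniformly random `k`-element vertex subset (the planted clique `PC`);
the observed graph is `plant g PC`. -/
noncomputable def pcMeasure (n k : ℕ) : Measure (ERGraph n × Finset (Fin n)) :=
  if h : (Finset.powersetCard k (Finset.univ : Finset (Fin n))).Nonempty then
    ((PMF.uniformOfFintype (ERGraph n)).bind fun g =>
      (PMF.uniformOfFinset _ h).map fun S => (g, S)).toMeasure
  else 0

/-- `d_{k̄,k}(G)(z)`: the maximum number of edges of a `k̄`-vertex subgraph of the planted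
clique graph `plant g PC` whose vertex set intersects the planted clique `PC` in exactly `z`
vertices. -/
def dPlant (n kb : ℕ) (g : ERGraph n) (PC : Finset (Fin n)) (z : ℕ) : ℕ :=
  ((Finset.powersetCard kb (Finset.univ : Finset (Fin n))).filter
      (fun S => (S ∩ PC).card = z)).sup (edgeCount (plant g PC))

/-- The natural-log binary entropy function. -/
noncomputable def binEnt (x : ℝ) : ℝ := -(x * Real.log x) - (1 - x) * Real.log (1 - x)

/-- The inverse of the binary entropy restricted to `[1/2, 1]`. -/
noncomputable def binEntInv (y : ℝ) : ℝ :=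
  Function.invFunOn binEnt (Set.Icc (1/2 : ℝ) 1) y

/-- The first moment curve `Γ_{k̄,k}(z)`, with the convention `Γ_{k,k}(k) = C(k,2)`. -/
noncomputable def Gamma (n k kb : ℕ) (z : ℕ) : ℝ :=
  if z = k ∧ kb = k then (k.choose 2 : ℝ)
  else (z.choose 2 : ℝ) +
    binEntInv (Real.log 2 -
        Real.log ((k.choose z : ℝ) * ((n - k).choose (kb - z) : ℝ)) /
          ((kb.choose 2 : ℝ) - (z.choose 2 : ℝ))) *
      ((kb.choose 2 : ℝ) - (z.choose 2 : ℝ))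


/-- `√(k̄/log(n/k̄))`, the basic overlap scale. -/
noncomputable def sqOv (n kb : ℕ) : ℝ :=
  Real.sqrt ((kb : ℝ) / Real.log ((n : ℝ) / (kb : ℝ)))

/-- `⌈√(k̄/log(n/k̄))⌉`, as a real number. -/
noncomputable def ovCeil (n kb : ℕ) : ℝ := (⌈sqOv n kb⌉₊ : ℝ)

/-- The Gibbs weight `exp(β |E[S]|)` of a vertex subset `S` in the planted graph. -/
noncomputable def gibbsWeight (n : ℕ) (β : ℝ) (g : ERGraph n) (PC S : Finset (Fin n)) : ℝ :=
  Real.exp (β * (edgeCount (plant g PC) S : ℝ))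

/-- Total Gibbs weight of a family `A` of vertex subsets. -/
noncomputable def gibbsMass (n : ℕ) (β : ℝ) (g : ERGraph n) (PC : Finset (Fin n))
    (A : Finset (Finset (Fin n))) : ℝ :=
  ∑ S ∈ A, gibbsWeight n β g PC S

/-- The Gibbs probability `π_β(A)` of a family `A` of `k̄`-vertex subsets. -/
noncomputable def gibbsProb (n kb : ℕ) (β : ℝ) (g : ERGraph n) (PC : Finset (Fin n))
    (A : Finset (Finset (Fin n))) : ℝ :=
  gibbsMass n β g PC A /
    gibbsMass n β g PC (Finset.powersetCard kb (Finset.univ : Finset (Fin n)))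

open Classical in
/-- The family of `k̄`-vertex subsets whose overlap with `PC` satisfies the predicate `P`. -/
noncomputable def ovSet (n kb : ℕ) (PC : Finset (Fin n)) (P : ℕ → Prop) :
    Finset (Finset (Fin n)) :=
  (Finset.powersetCard kb (Finset.univ : Finset (Fin n))).filter fun S => P ((S ∩ PC).card)

/-- `A₀`: `k̄`-subsets with overlap at most `⌊D₁ √(k̄/log(n/k̄))⌋`. -/
noncomputable def A0 (n kb : ℕ) (D₁ : ℝ) (PC : Finset (Fin n)) : Finset (Finset (Fin n)) :=
  ovSet n kb PC (fun m => m ≤ ⌊D₁ * sqOv n kb⌋₊)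

/-- `A₁`: `k̄`-subsets with overlap in `[⌈D₁ √(k̄/log(n/k̄))⌉, ⌈D₂ √(k̄/log(n/k̄))⌉]`. -/
noncomputable def A1 (n kb : ℕ) (D₁ D₂ : ℝ) (PC : Finset (Fin n)) : Finset (Finset (Fin n)) :=
  ovSet n kb PC (fun m => ⌈D₁ * sqOv n kb⌉₊ ≤ m ∧ m ≤ ⌈D₂ * sqOv n kb⌉₊)

/-- `A₂`: `k̄`-subsets with overlap at least `⌊k/2⌋`. -/
noncomputable def A2 (n kb k : ℕ) (PC : Finset (Fin n)) : Finset (Finset (Fin n)) :=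
  ovSet n kb PC (fun m => k / 2 ≤ m)

/-- The initial distribution `π_β(· | A₀ ∪ A₁)` of the MCMC dynamics. -/
noncomputable def initDist (n kb : ℕ) (β : ℝ) (g : ERGraph n) (PC : Finset (Fin n))
    (D₁ D₂ : ℝ) : Finset (Fin n) → ℝ :=
  fun S => if S ∈ A0 n kb D₁ PC ∪ A1 n kb D₁ D₂ PC then
    gibbsWeight n β g PC S / gibbsMass n β g PC (A0 n kb D₁ PC ∪ A1 n kb D₁ D₂ PC)
  else 0

open Classical in
/-- The probability that a Markov chain with transition kernel `Q` and initial
distribution `init` exits the family `good` of subsets by time `T`, i.e. `P(τ ≤ T)`. -/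
noncomputable def escapeProb {n : ℕ} (Q : Finset (Fin n) → Finset (Fin n) → ℝ)
    (init : Finset (Fin n) → ℝ) (good : Finset (Finset (Fin n))) (T : ℕ) : ℝ :=
  ∑ p ∈ (Finset.univ : Finset (Fin (T + 1) → Finset (Fin n))).filter
      (fun p => ∃ t : Fin (T + 1), t ≠ 0 ∧ p t ∉ good),
    init (p 0) * ∏ i : Fin T, Q (p i.castSucc) (p i.succ)

open Classical in
/-- The total weight of the trajectories of a stochastic kernel started at a point is `1`. -/
theorem sum_path_weight_cons {α : Type*} [Fintype α] {Q : α → α → ℝ} {Ω : Finset α}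
    (hsupp : ∀ x y, x ∈ Ω → Q x y ≠ 0 → y ∈ Ω) (hrow : ∀ x ∈ Ω, ∑ y, Q x y = 1)
    (T : ℕ) (x : α) (hx : x ∈ Ω) :
    ∑ q : Fin T → α, ∏ i : Fin T,
      Q ((Fin.cons x q : Fin (T + 1) → α) i.castSucc) ((Fin.cons x q : Fin (T + 1) → α) i.succ)
      = 1 := by
  induction T generalizing x with
  | zero => simp
  | succ T ih =>
    rw [← (Fin.consEquiv fun _ : Fin (T + 1) => α).sum_comp, Fintype.sum_prod_type, ← hrow x hx]
    refine Finset.sum_congr rfl fun y _ => ?_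
    have key : ∀ q : Fin T → α, ∏ i : Fin (T + 1),
        Q ((Fin.cons x (Fin.cons y q : Fin (T + 1) → α) : Fin (T + 2) → α) i.castSucc)
          ((Fin.cons x (Fin.cons y q : Fin (T + 1) → α) : Fin (T + 2) → α) i.succ)
        = Q x y * ∏ i : Fin T, Q ((Fin.cons y q : Fin (T + 1) → α) i.castSucc)
            ((Fin.cons y q : Fin (T + 1) → α) i.succ) := by
      intro q
      rw [Fin.prod_univ_succ]
      simp
    simp only [Fin.consEquiv, Equiv.coe_fn_mk, key, ← Finset.mul_sum]
    by_cases hy : Q x y = 0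
    · simp [hy]
    · rw [ih y (hsupp x y hx hy), mul_one]

open Classical in
/-- A Markov chain started from a stationary measure has that measure as its marginal at
every time. -/
theorem sum_path_weight_stationary {α : Type*} [Fintype α] {Q : α → α → ℝ} {Ω : Finset α}
    (hsupp : ∀ x y, x ∈ Ω → Q x y ≠ 0 → y ∈ Ω) (hrow : ∀ x ∈ Ω, ∑ y, Q x y = 1)
    {μ : α → ℝ} (hμ : ∀ x, x ∉ Ω → μ x = 0) (hstat : ∀ y, ∑ x, μ x * Q x y = μ y)
    (h : α → ℝ) (T : ℕ) (t : Fin (T + 1)) :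
    ∑ p : Fin (T + 1) → α, h (p t) * (μ (p 0) * ∏ i : Fin T, Q (p i.castSucc) (p i.succ))
      = ∑ x, h x * μ x := by
  induction T with
  | zero =>
    obtain rfl : t = 0 := Fin.fin_one_eq_zero t
    rw [← (Equiv.funUnique (Fin 1) α).symm.sum_comp]
    simp
  | succ T ih =>
    rw [← (Fin.consEquiv fun _ : Fin (T + 2) => α).sum_comp, Fintype.sum_prod_type]
    simp only [Fin.consEquiv, Equiv.coe_fn_mk, Fin.cons_zero]
    induction t using Fin.cases with
    | zero =>
      refine Finset.sum_congr rfl fun x _ => ?_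
      simp only [Fin.cons_zero, ← Finset.mul_sum]
      by_cases hx : x ∈ Ω
      · rw [sum_path_weight_cons hsupp hrow (T + 1) x hx, mul_one]
      · simp [hμ x hx]
    | succ t =>
      rw [← ih t, Finset.sum_comm]
      refine Finset.sum_congr rfl fun q _ => ?_
      rw [← hstat (q 0), Finset.sum_mul, Finset.mul_sum]
      refine Finset.sum_congr rfl fun x _ => ?_
      rw [Fin.prod_univ_succ]
      simp [mul_assoc]

/-- A sequence that leaves a predicate it starts in has a step at which it leaves. -/
theorem exists_exit_step {α : Type*} {P : α → Prop} {T : ℕ} {p : Fin (T + 1) → α}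
    (h0 : P (p 0)) (h : ∃ t, ¬ P (p t)) : ∃ i : Fin T, P (p i.castSucc) ∧ ¬ P (p i.succ) := by
  by_contra! hstep
  obtain ⟨t, ht⟩ := h
  exact ht (Fin.induction (motive := fun t => P (p t)) h0 hstep t)

open Classical in
/-- If a chain can leave `good` only through `bdry`, then the chain started from the stationary
measure `μ` conditioned on `good` leaves `good` within `T` steps with probability at most
`T * μ(bdry) / μ(good)`. -/
theorem escapeProb_le_of_stationary {n : ℕ} {Q : Finset (Fin n) → Finset (Fin n) → ℝ}
    {Ω good bdry : Finset (Finset (Fin n))} (hQ : ∀ x y, 0 ≤ Q x y)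
    (hsupp : ∀ x y, x ∈ Ω → Q x y ≠ 0 → y ∈ Ω) (hrow : ∀ x ∈ Ω, ∑ y, Q x y = 1)
    {μ init : Finset (Fin n) → ℝ} (hμ0 : ∀ x, 0 ≤ μ x) (hμ : ∀ x, x ∉ Ω → μ x = 0)
    (hstat : ∀ y, ∑ x, μ x * Q x y = μ y)
    {M : ℝ} (hM : 0 ≤ M) (hinit : ∀ x, init x = if x ∈ good then μ x / M else 0)
    (hbdry : ∀ x y, x ∈ good → y ∉ good → Q x y ≠ 0 → x ∈ bdry) (T : ℕ) :
    escapeProb Q init good T ≤ T * ((∑ x ∈ bdry, μ x) / M) := by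
  have hw : ∀ p : Fin (T + 1) → Finset (Fin n),
      0 ≤ μ (p 0) * ∏ i : Fin T, Q (p i.castSucc) (p i.succ) := fun p =>
    mul_nonneg (hμ0 _) (Finset.prod_nonneg fun i _ => hQ _ _)
  have hind : ∀ x : Finset (Fin n), (0 : ℝ) ≤ if x ∈ bdry then 1 else 0 := fun x => by
    split_ifs <;> norm_num
  calc escapeProb Q init good T
      ≤ ∑ p : Fin (T + 1) → Finset (Fin n), ∑ t : Fin T, (if p t.castSucc ∈ bdry then 1 else 0) *
          (μ (p 0) * ∏ i : Fin T, Q (p i.castSucc) (p i.succ)) / M := by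
        rw [escapeProb, Finset.sum_filter]
        refine Finset.sum_le_sum fun p _ => ?_
        have hnn : ∀ t ∈ (Finset.univ : Finset (Fin T)),
            0 ≤ (if p t.castSucc ∈ bdry then (1 : ℝ) else 0) *
              (μ (p 0) * ∏ i : Fin T, Q (p i.castSucc) (p i.succ)) / M := fun t _ =>
          div_nonneg (mul_nonneg (hind _) (hw p)) hM
        split_ifs with hp
        · rw [hinit]
          split_ifs with h0
          · by_cases hz : ∏ i : Fin T, Q (p i.castSucc) (p i.succ) = 0
            · rw [hz, mul_zero]
              exact hz ▸ Finset.sum_nonneg hnn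
            · obtain ⟨t, -, ht⟩ := hp
              obtain ⟨i, hi, hi'⟩ := exists_exit_step (P := (· ∈ good)) h0 ⟨t, ht⟩
              have hb := hbdry _ _ hi hi' (Finset.prod_ne_zero_iff.1 hz i (Finset.mem_univ i))
              refine le_trans (le_of_eq ?_) (Finset.single_le_sum hnn (Finset.mem_univ i))
              rw [if_pos hb]
              ring
          · rw [zero_mul]
            exact Finset.sum_nonneg hnn
        · exact Finset.sum_nonneg hnn
    _ = T * ((∑ x ∈ bdry, μ x) / M) := by
        rw [Finset.sum_comm]
        simp only [← Finset.sum_div]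
        rw [Finset.sum_congr rfl fun (t : Fin T) _ => sum_path_weight_stationary hsupp hrow hμ hstat
          (fun x => if x ∈ bdry then 1 else 0) T t.castSucc]
        simp [Finset.sum_ite_mem, mul_div_assoc]

/-- Exchanging a single vertex raises the overlap with a fixed set by at most one. -/
theorem card_inter_le_of_card_symmDiff_eq_two {α : Type*} [DecidableEq α] {S T : Finset α}
    (hcard : S.card = T.card) (h : (symmDiff S T).card = 2) (P : Finset α) :
    (T ∩ P).card ≤ (S ∩ P).card + 1 := by
  have h1 : (symmDiff S T).card = (S \ T).card + (T \ S).card := by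
    rw [symmDiff_def, Finset.sup_eq_union,
      Finset.card_union_of_disjoint (disjoint_sdiff_sdiff)]
  have h2 := Finset.card_sdiff_add_card_inter S T
  have h3 := Finset.card_sdiff_add_card_inter T S
  rw [Finset.inter_comm T S] at h3
  have h4 : T ∩ P ⊆ (S ∩ P) ∪ (T \ S) := by
    intro x hx
    simp only [Finset.mem_inter, Finset.mem_union, Finset.mem_sdiff] at hx ⊢
    tauto
  have h5 := (Finset.card_le_card h4).trans (Finset.card_union_le _ _)
  omega

theorem mem_A1_iff {n kb : ℕ} {D₁ D₂ : ℝ} {PC S : Finset (Fin n)} :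
    S ∈ A1 n kb D₁ D₂ PC ↔ S ∈ Finset.powersetCard kb Finset.univ ∧
      ⌈D₁ * sqOv n kb⌉₊ ≤ (S ∩ PC).card ∧ (S ∩ PC).card ≤ ⌈D₂ * sqOv n kb⌉₊ := by
  classical
  simp only [A1, ovSet, Finset.mem_filter]

theorem ceil_mul_sqOv_mono {n kb : ℕ} {D₁ D₂ : ℝ} (hD : D₁ ≤ D₂) :
    ⌈D₁ * sqOv n kb⌉₊ ≤ ⌈D₂ * sqOv n kb⌉₊ :=
  Nat.ceil_mono (mul_le_mul_of_nonneg_right hD (Real.sqrt_nonneg _))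

/-- `A₀ ∪ A₁` consists of the subsets with overlap at most `⌈D₂ √(k̄/log(n/k̄))⌉`. -/
theorem mem_A0_union_A1_iff {n kb : ℕ} {D₁ D₂ : ℝ} (hD : D₁ ≤ D₂)
    {PC S : Finset (Fin n)} :
    S ∈ A0 n kb D₁ PC ∪ A1 n kb D₁ D₂ PC ↔ S ∈ Finset.powersetCard kb Finset.univ ∧
      (S ∩ PC).card ≤ ⌈D₂ * sqOv n kb⌉₊ := by
  classical
  have h1 := ceil_mul_sqOv_mono (n := n) (kb := kb) hD
  have h2 := Nat.floor_le_ceil (D₁ * sqOv n kb)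
  have h3 := Nat.ceil_le_floor_add_one (D₁ * sqOv n kb)
  rw [Finset.mem_union, mem_A1_iff]
  simp only [A0, ovSet, Finset.mem_filter, ← and_or_left]
  refine and_congr_right fun _ => ?_
  omega

theorem gibbsWeight_pos (n : ℕ) (β : ℝ) (g : ERGraph n) (PC S : Finset (Fin n)) :
    0 < gibbsWeight n β g PC S :=
  Real.exp_pos _

theorem gibbsMass_nonneg (n : ℕ) (β : ℝ) (g : ERGraph n) (PC : Finset (Fin n))
    (A : Finset (Finset (Fin n))) : 0 ≤ gibbsMass n β g PC A :=
  Finset.sum_nonneg fun _ _ => (gibbsWeight_pos _ _ _ _ _).le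

theorem gibbsMass_mono {n : ℕ} {β : ℝ} {g : ERGraph n} {PC : Finset (Fin n)}
    {A B : Finset (Finset (Fin n))} (h : A ⊆ B) : gibbsMass n β g PC A ≤ gibbsMass n β g PC B :=
  Finset.sum_le_sum_of_subset_of_nonneg h fun _ _ _ => (gibbsWeight_pos _ _ _ _ _).le

/-- A nearest-neighbour chain reversible for the Gibbs measure, started from
`π_β(·|A₀ ∪ A₁)`, leaves `A₀ ∪ A₁` within `T` steps with probability at most
`T * π_β(A₁) / π_β(A₀ ∪ A₁)`. -/
theorem escapeProb_initDist_le {n kb : ℕ} {β : ℝ} {g : ERGraph n} {PC : Finset (Fin n)}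
    {D₁ D₂ : ℝ} (hD : D₁ ≤ D₂) {Q : Finset (Fin n) → Finset (Fin n) → ℝ}
    (hQnn : ∀ S T, 0 ≤ Q S T)
    (hQstoch : ∀ S, S ∈ Finset.powersetCard kb (Finset.univ : Finset (Fin n)) →
      ∑ T ∈ Finset.powersetCard kb (Finset.univ : Finset (Fin n)), Q S T = 1)
    (hQsupp : ∀ S T, S ∈ Finset.powersetCard kb (Finset.univ : Finset (Fin n)) → Q S T ≠ 0 →
      T ∈ Finset.powersetCard kb (Finset.univ : Finset (Fin n)) ∧
        (S = T ∨ (symmDiff S T).card = 2))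
    (hQrev : ∀ S T, gibbsWeight n β g PC S * Q S T = gibbsWeight n β g PC T * Q T S) (T : ℕ) :
    escapeProb Q (initDist n kb β g PC D₁ D₂) (A0 n kb D₁ PC ∪ A1 n kb D₁ D₂ PC) T ≤
      T * (gibbsMass n β g PC (A1 n kb D₁ D₂ PC) /
        gibbsMass n β g PC (A0 n kb D₁ PC ∪ A1 n kb D₁ D₂ PC)) := by
  classical
  set Ω := Finset.powersetCard kb (Finset.univ : Finset (Fin n)) with hΩ
  have hsupp : ∀ x y, x ∈ Ω → Q x y ≠ 0 → y ∈ Ω := fun x y hx hxy => (hQsupp x y hx hxy).1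
  have hrow : ∀ x ∈ Ω, ∑ y, Q x y = 1 := fun x hx => by
    rw [← hQstoch x hx]
    refine (Finset.sum_subset (Finset.subset_univ _) fun y _ hy => ?_).symm
    by_contra hne
    exact hy (hsupp x y hx hne)
  let μ : Finset (Fin n) → ℝ := fun S => if S ∈ Ω then gibbsWeight n β g PC S else 0
  have hμ : ∀ x, x ∉ Ω → μ x = 0 := fun x hx => if_neg hx
  have hμΩ : ∀ x ∈ Ω, μ x = gibbsWeight n β g PC x := fun x hx => if_pos hx
  have hrev : ∀ x y, μ x * Q x y = μ y * Q y x := by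
    have hcross : ∀ x y, x ∈ Ω → y ∉ Ω → μ x * Q x y = μ y * Q y x := fun x y hx hy => by
      rw [hμ y hy, zero_mul, not_not.1 fun h => hy (hsupp x y hx h), mul_zero]
    intro x y
    by_cases hx : x ∈ Ω <;> by_cases hy : y ∈ Ω
    · rw [hμΩ x hx, hμΩ y hy, hQrev]
    · exact hcross x y hx hy
    · exact (hcross y x hy hx).symm
    · rw [hμ x hx, hμ y hy, zero_mul, zero_mul]
  have hstat : ∀ y, ∑ x, μ x * Q x y = μ y := fun y => by
    simp only [hrev _ y, ← Finset.mul_sum]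
    by_cases hy : y ∈ Ω
    · rw [hrow y hy, mul_one]
    · rw [hμ y hy, zero_mul]
  have hbdryMass : gibbsMass n β g PC (A1 n kb D₁ D₂ PC) = ∑ x ∈ A1 n kb D₁ D₂ PC, μ x :=
    Finset.sum_congr rfl fun x hx => (hμΩ x (mem_A1_iff.1 hx).1).symm
  rw [hbdryMass]
  refine escapeProb_le_of_stationary hQnn hsupp hrow
    (fun x => ?_) hμ hstat (gibbsMass_nonneg _ _ _ _ _) (fun x => ?_) (fun x y hx hy hxy => ?_) T
  · by_cases hx : x ∈ Ω
    · exact hμΩ x hx ▸ (gibbsWeight_pos _ _ _ _ _).le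
    · exact (hμ x hx).ge
  · unfold initDist
    split_ifs with hx
    · rw [hμΩ x ((mem_A0_union_A1_iff hD).1 hx).1]
    · rfl
  · rw [mem_A0_union_A1_iff hD] at hx hy
    obtain ⟨hyΩ, hstep⟩ := hQsupp x y hx.1 hxy
    have hlt : ⌈D₂ * sqOv n kb⌉₊ < (y ∩ PC).card := not_le.1 fun h => hy ⟨hyΩ, h⟩
    rw [mem_A1_iff]
    refine ⟨hx.1, ?_, hx.2⟩
    have hmono := ceil_mul_sqOv_mono (n := n) (kb := kb) hD
    rcases hstep with rfl | h2
    · exact absurd hx.2 hlt.not_ge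
    · have hcard : x.card = y.card :=
        (Finset.mem_powersetCard.1 hx.1).2.trans (Finset.mem_powersetCard.1 hyΩ).2.symm
      have := card_inter_le_of_card_symmDiff_eq_two hcard h2 PC
      omega

/-- A lower bound on `π_β(A)` relative to `π_β(B)`, for families of `k̄`-subsets, bounds the
fraction of the mass of any larger family that lies in `B`. -/
theorem gibbsMass_div_le_exp_neg {n kb : ℕ} {β : ℝ} {g : ERGraph n} {PC : Finset (Fin n)}
    {A B C : Finset (Finset (Fin n))} {x : ℝ} (hAC : A ⊆ C)
    (hB : B ⊆ Finset.powersetCard kb Finset.univ)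
    (h : Real.exp x * gibbsProb n kb β g PC B ≤ gibbsProb n kb β g PC A) :
    gibbsMass n β g PC B / gibbsMass n β g PC C ≤ Real.exp (-x) := by
  rcases (gibbsMass_nonneg n β g PC C).eq_or_lt with hC | hC
  · rw [← hC, div_zero]
    exact (Real.exp_pos _).le
  rw [div_le_iff₀ hC, Real.exp_neg, inv_mul_eq_div, le_div_iff₀' (Real.exp_pos x)]
  refine le_trans ?_ (gibbsMass_mono hAC)
  rcases (gibbsMass_nonneg n β g PC (Finset.powersetCard kb Finset.univ)).eq_or_lt with hZ | hZ
  · have hB0 : gibbsMass n β g PC B = 0 :=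
      le_antisymm ((gibbsMass_mono hB).trans hZ.ge) (gibbsMass_nonneg _ _ _ _ _)
    rw [hB0, mul_zero]
    exact gibbsMass_nonneg _ _ _ _ _
  · rwa [gibbsProb, gibbsProb, ← mul_div_assoc, div_le_div_iff_of_pos_right hZ] at h

theorem pcMeasure_le_one (n k : ℕ) (s : Set (ERGraph n × Finset (Fin n))) :
    pcMeasure n k s ≤ 1 := by
  unfold pcMeasure
  split_ifs
  · exact prob_le_one
  · simp

/-- If the free energy well property holds (w.h.p.), then any reversible
nearest-neighbour dynamics for `π_β` started from `π_β(·|A₀ ∪ A₁)` satisfies, for every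
`T > 0`, `P(τ_β ≤ T) ≤ T·exp(−Ω(β k̄/log(n/k̄)))` w.h.p. as `n → ∞`. -/
theorem slow_escape_from_few
    (k kb : ℕ → ℕ) (D₁ D₂ : ℝ) (β : ℕ → ℝ)
    (hD₁ : 0 < D₁) (hD : D₁ < D₂)
    (Q : ∀ n : ℕ, ERGraph n × Finset (Fin n) → Finset (Fin n) → Finset (Fin n) → ℝ)
    -- the kernel is nonnegative and row-stochastic on the `k̄`-subsets
    (hQnn : ∀ n ω S T, 0 ≤ Q n ω S T)
    (hQstoch : ∀ n ω S, S ∈ Finset.powersetCard (kb n) (Finset.univ : Finset (Fin n)) →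
      ∑ T ∈ Finset.powersetCard (kb n) (Finset.univ : Finset (Fin n)), Q n ω S T = 1)
    -- the dynamics is nearest-neighbour: it moves only between `k̄`-subsets at
    -- Hamming distance `2` (or stays in place)
    (hQsupp : ∀ n ω S T, S ∈ Finset.powersetCard (kb n) (Finset.univ : Finset (Fin n)) →
      Q n ω S T ≠ 0 →
      T ∈ Finset.powersetCard (kb n) (Finset.univ : Finset (Fin n)) ∧
        (S = T ∨ (symmDiff S T).card = 2))
    -- the dynamics is reversible with respect to the Gibbs measure `π_β`
    (hQrev : ∀ n ω S T,
      gibbsWeight n (β n) ω.1 ω.2 S * Q n ω S T = gibbsWeight n (β n) ω.1 ω.2 T * Q n ω T S)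
    -- the free energy well property holds w.h.p.
    (hFEW : ∃ c : ℝ, 0 < c ∧
      Tendsto (fun n : ℕ =>
        pcMeasure n (k n) {ω : ERGraph n × Finset (Fin n) |
          Real.exp (c * β n * (kb n : ℝ) / Real.log ((n : ℝ) / (kb n : ℝ))) *
              gibbsProb n (kb n) (β n) ω.1 ω.2 (A1 n (kb n) D₁ D₂ ω.2) ≤
            min (gibbsProb n (kb n) (β n) ω.1 ω.2 (A0 n (kb n) D₁ ω.2))
              (gibbsProb n (kb n) (β n) ω.1 ω.2 (A2 n (kb n) (k n) ω.2))})
        atTop (nhds 1)) :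
    ∃ c' : ℝ, 0 < c' ∧ ∀ T : ℕ, 0 < T →
      Tendsto (fun n : ℕ =>
        pcMeasure n (k n) {ω : ERGraph n × Finset (Fin n) |
          escapeProb (Q n ω) (initDist n (kb n) (β n) ω.1 ω.2 D₁ D₂)
              (A0 n (kb n) D₁ ω.2 ∪ A1 n (kb n) D₁ D₂ ω.2) T ≤
            (T : ℝ) * Real.exp (-(c' * β n * (kb n : ℝ) / Real.log ((n : ℝ) / (kb n : ℝ))))})
        atTop (nhds 1) := by
  obtain ⟨c, hc, hlim⟩ := hFEW
  refine ⟨c, hc, fun T _ => ?_⟩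
  refine tendsto_of_tendsto_of_tendsto_of_le_of_le hlim tendsto_const_nhds
    (fun n => measure_mono fun ω hω => ?_) fun n => pcMeasure_le_one _ _ _
  refine (escapeProb_initDist_le hD.le (hQnn n ω) (hQstoch n ω) (hQsupp n ω) (hQrev n ω) T).trans ?_
  refine mul_le_mul_of_nonneg_left ?_ T.cast_nonneg
  exact gibbsMass_div_le_exp_neg Finset.subset_union_left (fun S hS => (mem_A1_iff.1 hS).1)
    (le_trans hω (min_le_left _ _))

end
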